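/- Let K ⊆ ℝ³ be a compact convex set with nonempty interior which is strictly convex, and let H = {y ∈ ℝ³ : ⟪y, u⟫ ≥ c} be a closed half-space (u ≠ 0) such that K is not contained in H. Then the set H ∩ frontier K is either empty, or a singleton, or homeomorphic (in the subspace topology) to the closed unit disk {z ∈ ℝ² : ‖z‖ ≤ 1}. -/

import Mathlib

open scoped RealInnerProductSpace

/-- Radial projection from the interior point `0` onto the plane `φ = d`. -/
theorem cap_homeo_slice {E : Type*} [NormedAddCommGroup E] [NormedSpace ℝ E]
    (D : Set E) (hD : IsCompact D) (hc : Convex ℝ D) (h0 : D ∈ nhds (0 : E))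
    (φ : E →L[ℝ] ℝ) (d : ℝ) (hd : 0 < d) :
    Nonempty ((({y : E | d ≤ φ y} ∩ frontier D : Set E)) ≃ₜ
      ({y : E | φ y = d} ∩ D : Set E)) := by
  have habs : Absorbent ℝ D := absorbent_nhds_zero h0
  have hcl : IsClosed D := hD.isClosed
  have hvb : Bornology.IsVonNBounded ℝ D :=
    (NormedSpace.isVonNBounded_iff ℝ).2 hD.isBounded
  have hcap : IsCompact ({y : E | d ≤ φ y} ∩ frontier D : Set E) :=
    (hD.of_isClosed_subset isClosed_frontier hcl.frontier_subset).inter_left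
      (isClosed_le continuous_const φ.continuous)
  have hmem : ∀ x, x ∈ D ↔ gauge D x ≤ 1 := fun x => by
    rw [gauge_le_one_iff_mem_closure hc h0, hcl.closure_eq]
  have hfr : ∀ x, x ∈ frontier D ↔ gauge D x = 1 := fun x =>
    (gauge_eq_one_iff_mem_frontier hc h0).symm
  let f : (({y : E | d ≤ φ y} ∩ frontier D : Set E)) → ({y : E | φ y = d} ∩ D : Set E) :=
    fun y => ⟨(d / φ y.1) • y.1, by
      obtain ⟨y, hy1, hy2⟩ := y
      have hy1' : d ≤ φ y := hy1
      have hpos : 0 < φ y := hd.trans_le hy1'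
      constructor
      · show φ ((d / φ y) • y) = d
        rw [map_smul, smul_eq_mul]; field_simp
      · rw [hmem, gauge_smul_of_nonneg (by positivity), (hfr y).1 hy2, smul_eq_mul, mul_one]
        exact (div_le_one hpos).2 hy1'⟩
  have hf : Continuous f := by
    refine Continuous.subtype_mk ?_ _
    refine Continuous.smul (Continuous.div continuous_const (by fun_prop) ?_) continuous_subtype_val
    rintro ⟨y, hy1, hy2⟩
    exact (hd.trans_le hy1).ne'
  have hbij : Function.Bijective f := by
    constructor
    · rintro ⟨y, hy1, hy2⟩ ⟨z, hz1, hz2⟩ h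
      have h' : (d / φ y) • y = (d / φ z) • z := congrArg Subtype.val h
      have hy : 0 < d / φ y := div_pos hd (hd.trans_le hy1)
      have hz : 0 < d / φ z := div_pos hd (hd.trans_le hz1)
      have hg := congrArg (gauge D) h'
      rw [gauge_smul_of_nonneg hy.le, gauge_smul_of_nonneg hz.le, (hfr y).1 hy2,
        (hfr z).1 hz2, smul_eq_mul, smul_eq_mul, mul_one, mul_one] at hg
      rw [← hg] at h'
      exact Subtype.ext (smul_right_injective E hy.ne' h')
    · rintro ⟨x, hx1, hx2⟩
      have hx1' : φ x = d := hx1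
      have hx0 : x ≠ 0 := by
        rintro rfl
        rw [map_zero] at hx1'
        exact hd.ne hx1'
      have hg : 0 < gauge D x := (gauge_pos habs hvb).2 hx0
      have hφ : φ ((gauge D x)⁻¹ • x) = (gauge D x)⁻¹ * d := by
        rw [map_smul, smul_eq_mul, hx1']
      refine ⟨⟨(gauge D x)⁻¹ • x, ?_, ?_⟩, ?_⟩
      · show d ≤ φ ((gauge D x)⁻¹ • x)
        rw [hφ]
        exact le_mul_of_one_le_left hd.le ((one_le_inv₀ hg).2 ((hmem x).1 hx2))
      · rw [hfr, gauge_smul_of_nonneg (by positivity), smul_eq_mul, inv_mul_cancel₀ hg.ne']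
      · apply Subtype.ext
        show (d / φ ((gauge D x)⁻¹ • x)) • ((gauge D x)⁻¹ • x) = x
        rw [hφ, smul_smul]
        have : d / ((gauge D x)⁻¹ * d) * (gauge D x)⁻¹ = 1 := by field_simp
        rw [this, one_smul]
  haveI := isCompact_iff_compactSpace.1 hcap
  exact ⟨Continuous.homeoOfEquivCompactToT2 (f := Equiv.ofBijective f hbij) hf⟩

/-- A planar slice through an interior point of a convex body is a disk. -/
theorem slice_homeo_disk (K : Set (EuclideanSpace ℝ (Fin 3)))
    (hK : IsCompact K) (hc : Convex ℝ K) (u p : EuclideanSpace ℝ (Fin 3)) (hu : u ≠ 0)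
    (hp : p ∈ interior K) :
    Nonempty (({y | ⟪y, u⟫ = ⟪p, u⟫} ∩ K : Set (EuclideanSpace ℝ (Fin 3))) ≃ₜ
      {z : EuclideanSpace ℝ (Fin 2) | ‖z‖ ≤ 1}) := by
  haveI : Fact (Module.finrank ℝ (EuclideanSpace ℝ (Fin 3)) = 2 + 1) := ⟨by simp⟩
  have hfin : Module.finrank ℝ (ℝ ∙ u)ᗮ = 2 := Submodule.finrank_orthogonal_span_singleton hu
  let e : EuclideanSpace ℝ (Fin 2) ≃ₗᵢ[ℝ] (ℝ ∙ u)ᗮ :=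
    ((stdOrthonormalBasis ℝ (ℝ ∙ u)ᗮ).reindex (finCongr hfin)).repr.symm
  let g : EuclideanSpace ℝ (Fin 2) → EuclideanSpace ℝ (Fin 3) := fun v => p + (e v : _)
  have hgc : Continuous g := by fun_prop
  have hgi : Isometry g := by
    refine Isometry.of_dist_eq fun a b => ?_
    simp only [g, dist_add_left]
    rw [← Subtype.dist_eq]
    exact e.isometry.dist_eq a b
  have hge : Topology.IsClosedEmbedding g := hgi.isClosedEmbedding
  have hgu : ∀ v, ⟪g v, u⟫ = ⟪p, u⟫ := fun v => by
    have := Submodule.mem_orthogonal_singleton_iff_inner_left.1 (e v).2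
    simp [g, inner_add_left, this]
  let S := g ⁻¹' K
  have hS : IsCompact S := hge.isCompact_preimage hK
  have hSc : Convex ℝ S := by
    intro a ha b hb s t hs ht hst
    have := hc ha hb hs ht hst
    show g _ ∈ K
    convert this using 1
    simp only [g, map_add, map_smul, Submodule.coe_add, Submodule.coe_smul, smul_add]
    nth_rewrite 1 [← one_smul ℝ p]
    rw [← hst, add_smul]; abel
  have hS0 : (interior S).Nonempty := by
    refine ⟨0, preimage_interior_subset_interior_preimage hgc ?_⟩
    show g 0 ∈ interior K
    simpa [g] using hp
  obtain ⟨h, h1, h2, h3⟩ := exists_homeomorph_image_interior_closure_frontier_eq_unitBall hSc hS0 hS.isBounded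
  rw [hS.isClosed.closure_eq] at h2
  have e1 : S ≃ₜ {z : EuclideanSpace ℝ (Fin 2) | ‖z‖ ≤ 1} :=
    (h.image S).trans (Homeomorph.setCongr (by rw [h2]; ext z; simp))
  have himg : g '' S = ({y | ⟪y, u⟫ = ⟪p, u⟫} ∩ K : Set _) := by
    ext y
    constructor
    · rintro ⟨v, hv, rfl⟩
      exact ⟨hgu v, hv⟩
    · rintro ⟨hy1, hy2⟩
      have hy1' : ⟪y, u⟫ = ⟪p, u⟫ := hy1
      have hm : y - p ∈ (ℝ ∙ u)ᗮ := by
        rw [Submodule.mem_orthogonal_singleton_iff_inner_left, inner_sub_left, hy1', sub_self]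
      have hg : g (e.symm ⟨y - p, hm⟩) = y := by simp [g]
      exact ⟨_, by show g _ ∈ K; rwa [hg], hg⟩
  have e2 : S ≃ₜ g '' S := hge.isEmbedding.homeomorphImage S
  exact ⟨(Homeomorph.setCongr himg.symm).trans (e2.symm.trans e1)⟩

/-- For a strictly convex body `K ⊆ ℝ³` and a closed half-space
`H = {y | ⟪y, u⟫ ≥ c}` not containing `K`, the set `H ∩ frontier K` is empty, a
singleton, or homeomorphic to the closed unit disk. -/
theorem halfspace_inter_frontier_trichotomy
    (K : Set (EuclideanSpace ℝ (Fin 3)))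
    (hKcomp : IsCompact K) (hKconv : Convex ℝ K)
    (hKint : (interior K).Nonempty) (hKstrict : StrictConvex ℝ K)
    (u : EuclideanSpace ℝ (Fin 3)) (hu : u ≠ 0) (c : ℝ)
    (hKH : ¬ K ⊆ {y : EuclideanSpace ℝ (Fin 3) | c ≤ ⟪y, u⟫}) :
    ({y : EuclideanSpace ℝ (Fin 3) | c ≤ ⟪y, u⟫} ∩ frontier K = ∅) ∨
    (∃ p, {y : EuclideanSpace ℝ (Fin 3) | c ≤ ⟪y, u⟫} ∩ frontier K = {p}) ∨
    Nonempty
      ((({y : EuclideanSpace ℝ (Fin 3) | c ≤ ⟪y, u⟫} ∩ frontier K :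
          Set (EuclideanSpace ℝ (Fin 3)))) ≃ₜ
        {z : EuclideanSpace ℝ (Fin 2) | ‖z‖ ≤ 1}) := by
  have hcl : IsClosed K := hKcomp.isClosed
  have hcont : Continuous fun y : EuclideanSpace ℝ (Fin 3) => ⟪y, u⟫ := by fun_prop
  have hdense : K ⊆ closure (interior K) := by
    rw [hKconv.closure_interior_eq_closure_of_nonempty_interior hKint]
    exact subset_closure
  by_cases hbig : ∃ x ∈ K, c < ⟪x, u⟫
  · right; right
    obtain ⟨a, haK, hac⟩ := hbig
    obtain ⟨b, hbK, hbc⟩ := Set.not_subset.1 hKH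
    have hbc' : ⟪b, u⟫ < c := not_le.1 hbc
    obtain ⟨a', ha', ha'K⟩ := mem_closure_iff.1 (hdense haK) _
      (isOpen_lt continuous_const hcont) hac
    obtain ⟨q, hq, hqK⟩ := mem_closure_iff.1 (hdense hbK) _
      (isOpen_lt hcont continuous_const) hbc'
    have hq' : ⟪q, u⟫ < c := hq
    have ha'' : c < ⟪a', u⟫ := ha'
    obtain ⟨p, hpK, hpc⟩ := hKconv.interior.isPreconnected.intermediate_value hqK ha'K
      hcont.continuousOn ⟨hq'.le, ha''.le⟩
    have hpc' : ⟪p, u⟫ = c := hpc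
    obtain ⟨e2⟩ := slice_homeo_disk K hKcomp hKconv u p hu hpK
    let τ := Homeomorph.addRight q
    have hτ : ∀ x, τ x = x + q := fun x => rfl
    obtain ⟨e1⟩ := cap_homeo_slice (τ ⁻¹' K) (τ.isCompact_preimage.2 hKcomp)
      (hKconv.translate_preimage_left q)
      (by
        apply τ.continuous.continuousAt
        rw [hτ, zero_add]
        exact mem_interior_iff_mem_nhds.1 hqK)
      (innerSL ℝ u) (c - ⟪q, u⟫) (sub_pos.2 hq')
    have hin : ∀ x, innerSL ℝ u x = ⟪x, u⟫ := fun x => by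
      rw [innerSL_apply_apply, real_inner_comm]
    have s1 : ({y | c - ⟪q, u⟫ ≤ innerSL ℝ u y} ∩ frontier (τ ⁻¹' K) : Set _) =
        τ ⁻¹' ({y | c ≤ ⟪y, u⟫} ∩ frontier K) := by
      rw [← τ.preimage_frontier]
      ext y
      simp only [Set.mem_inter_iff, Set.mem_setOf_eq, Set.mem_preimage, hin, hτ,
        inner_add_left, sub_le_iff_le_add]
    have s2 : ({y | innerSL ℝ u y = c - ⟪q, u⟫} ∩ (τ ⁻¹' K) : Set _) =
        τ ⁻¹' ({y | ⟪y, u⟫ = ⟪p, u⟫} ∩ K) := by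
      ext y
      simp only [Set.mem_inter_iff, Set.mem_setOf_eq, Set.mem_preimage, hin, hτ,
        inner_add_left, eq_sub_iff_add_eq, hpc']
    rw [s1, s2] at e1
    have pre : ∀ T : Set (EuclideanSpace ℝ (Fin 3)), Nonempty ((τ ⁻¹' T : Set _) ≃ₜ T) :=
      fun T => ⟨τ.sets rfl⟩
    obtain ⟨t1⟩ := pre ({y | c ≤ ⟪y, u⟫} ∩ frontier K)
    obtain ⟨t2⟩ := pre ({y | ⟪y, u⟫ = ⟪p, u⟫} ∩ K)
    exact ⟨t1.symm.trans (e1.trans (t2.trans e2))⟩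
  · push Not at hbig
    rcases Set.eq_empty_or_nonempty
      ({y : EuclideanSpace ℝ (Fin 3) | c ≤ ⟪y, u⟫} ∩ frontier K) with h | ⟨p, hp1, hp2⟩
    · exact Or.inl h
    right; left
    refine ⟨p, Set.eq_singleton_iff_unique_mem.2 ⟨⟨hp1, hp2⟩, ?_⟩⟩
    rintro y ⟨hy1, hy2⟩
    by_contra hne
    have hyK := hcl.frontier_subset hy2
    have hpK := hcl.frontier_subset hp2
    have hy : ⟪y, u⟫ = c := le_antisymm (hbig y hyK) hy1
    have hp : ⟪p, u⟫ = c := le_antisymm (hbig p hpK) hp1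
    have hm := hKstrict hyK hpK hne (a := 1/2) (b := 1/2) (by norm_num) (by norm_num) (by norm_num)
    set m := (1/2 : ℝ) • y + (1/2 : ℝ) • p with hmdef
    have hmc : ⟪m, u⟫ = c := by
      rw [hmdef, inner_add_left, real_inner_smul_left, real_inner_smul_left, hy, hp]; ring
    have hK' : ∀ᶠ t : ℝ in nhds 0, m + t • u ∈ K := by
      have hct : Continuous fun t : ℝ => m + t • u := by fun_prop
      apply hct.continuousAt
      simpa using mem_interior_iff_mem_nhds.1 hm
    obtain ⟨ε, hε, hball⟩ := Metric.eventually_nhds_iff.1 hK'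
    have := hbig _ (hball (y := ε / 2) (by
      rw [Real.dist_eq, sub_zero, abs_of_pos (by positivity)]; linarith))
    rw [inner_add_left, real_inner_smul_left, hmc] at this
    have h2 : 0 < ⟪u, u⟫ := real_inner_self_pos.2 hu
    have : 0 < ε / 2 * ⟪u, u⟫ := by positivity
    linarith
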